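/- Let K ≥ 2, θ ∈ Δ with θ_k > 0, and define T : ℝ^K → ℝ^K by T(w) = w_k · θ + Σ_{ℓ≠k} w_ℓ · V_ℓ. Let μ denote the (K−1)-dimensional Hausdorff measure on the affine hyperplane {z ∈ ℝ^K : Σ_ℓ z_ℓ = 1}. Then for every measurable subset A of Δ, μ(T(A)) = θ_k · μ(A). Consequently, the image under T of the uniform probability measure on Δ is the uniform probability measure on Δ_k(θ). -/

import Mathlib

open MeasureTheory

noncomputable section

/-- The probability simplex inside `EuclideanSpace ℝ (Fin K)`. -/
def esimplex (K : ℕ) : Set (EuclideanSpace ℝ (Fin K)) :=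
  {z | (∀ i, 0 ≤ z i) ∧ ∑ i, z i = 1}

/-- The `ℓ`-th vertex of the probability simplex (standard basis vector). -/
def evtx (K : ℕ) (ℓ : Fin K) : EuclideanSpace ℝ (Fin K) :=
  (EuclideanSpace.equiv (Fin K) ℝ).symm (fun i => if i = ℓ then 1 else 0)

/-- The subsimplex `Δ_k(θ)`: convex hull of `{θ} ∪ {V_ℓ : ℓ ≠ k}`. -/
def esubsimplex (K : ℕ) (k : Fin K) (θ : EuclideanSpace ℝ (Fin K)) :
    Set (EuclideanSpace ℝ (Fin K)) :=
  convexHull ℝ (insert θ {z | ∃ ℓ : Fin K, ℓ ≠ k ∧ z = evtx K ℓ})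

/-- The uniform probability measure on a set `S`: the normalized restriction of `μ` to `S`. -/
def unifOn (K : ℕ) (μ : Measure (EuclideanSpace ℝ (Fin K)))
    (S : Set (EuclideanSpace ℝ (Fin K))) : Measure (EuclideanSpace ℝ (Fin K)) :=
  (μ S)⁻¹ • μ.restrict S

open Module in
/-- On a level set of the functional `s`, the map `x ↦ x + f x • u` with `s u = 0` scales the
Hausdorff measure of codimension one by `|1 + f u|`. -/
theorem hausdorffMeasure_image_transvection {E : Type*} [NormedAddCommGroup E] [NormedSpace ℝ E]
    [FiniteDimensional ℝ E] [MeasurableSpace E] [BorelSpace E] {s : Dual ℝ E} (hs : s ≠ 0)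
    (f : Dual ℝ E) {u : E} (hu : s u = 0) {c : ℝ} {A : Set E} (hA : ∀ x ∈ A, s x = c) :
    μH[(finrank ℝ E : ℝ) - 1] (LinearMap.transvection f u '' A) =
      ENNReal.ofReal |1 + f u| * μH[(finrank ℝ E : ℝ) - 1] A := by
  rcases A.eq_empty_or_nonempty with rfl | ⟨p, hp⟩
  · simp
  have hdim : (finrank ℝ E : ℝ) - 1 = (finrank ℝ (LinearMap.ker s) : ℝ) := by
    have := Dual.finrank_ker_add_one_of_ne_zero hs
    rw [← this]
    simp
  rw [hdim]
  let ι : E → LinearMap.ker s → E := fun q v => q + v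
  have hι : ∀ q, Isometry (ι q) := fun q =>
    (isometry_add_left q).comp isometry_subtype_coe
  let B : Set (LinearMap.ker s) := ι p ⁻¹' A
  have hAB : A = ι p '' B := by
    refine (Set.image_preimage_eq_of_subset fun x hx => ?_).symm
    exact ⟨⟨x - p, by simp [hA x hx, hA p hp]⟩, by simp [ι]⟩
  let L := LinearMap.transvection (f.comp (LinearMap.ker s).subtype) ⟨u, hu⟩
  have hL : LinearMap.transvection f u '' A = ι (p + f p • u) '' (L '' B) := by
    rw [hAB, Set.image_image, Set.image_image]
    refine Set.image_congr fun v _ => ?_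
    simp only [ι, L, LinearMap.transvection.apply, map_add, LinearMap.comp_apply,
      Submodule.subtype_apply, Submodule.coe_add, Submodule.coe_smul]
  have hdet : LinearMap.det L = 1 + f u := LinearMap.transvection.det _ _
  rw [hL, (hι _).hausdorffMeasure_image (Or.inl (Nat.cast_nonneg _)),
    Measure.addHaar_image_linearMap, hdet, hAB,
    (hι _).hausdorffMeasure_image (Or.inl (Nat.cast_nonneg _))]

theorem evtx_apply (K : ℕ) (ℓ i : Fin K) : evtx K ℓ i = if i = ℓ then 1 else 0 := rfl

theorem sum_smul_evtx {K : ℕ} (z : EuclideanSpace ℝ (Fin K)) : ∑ ℓ, z ℓ • evtx K ℓ = z := by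
  ext i
  simp [evtx_apply]

theorem convex_esimplex (K : ℕ) : Convex ℝ (esimplex K) := by
  rintro x ⟨hx, hx'⟩ y ⟨hy, hy'⟩ a b ha hb hab
  refine ⟨fun i => ?_, ?_⟩
  · have := hx i
    have := hy i
    simp only [PiLp.add_apply, PiLp.smul_apply, smul_eq_mul]
    positivity
  · simp [Finset.sum_add_distrib, ← Finset.mul_sum, hx', hy', hab]

theorem esimplex_eq_convexHull (K : ℕ) : esimplex K = convexHull ℝ (Set.range (evtx K)) := by
  refine Set.Subset.antisymm (fun z hz => ?_) (convexHull_min ?_ (convex_esimplex K))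
  · rw [← sum_smul_evtx z]
    exact (convex_convexHull ℝ _).sum_mem (fun i _ => hz.1 i) hz.2
      fun i _ => subset_convexHull ℝ _ ⟨i, rfl⟩
  · rintro _ ⟨ℓ, rfl⟩
    refine ⟨fun i => ?_, by simp [evtx_apply]⟩
    rw [evtx_apply]
    split_ifs <;> norm_num

theorem measurableSet_esimplex (K : ℕ) : MeasurableSet (esimplex K) := by
  rw [esimplex_eq_convexHull]
  exact ((Set.finite_range _).isCompact_convexHull ℝ).measurableSet

/-- A measurable embedding scaling the measure of all measurable subsets of `S` by a constant
pushes the uniform measure on `S` to the uniform measure on its image. -/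
theorem map_unifOn {K : ℕ} {μ : Measure (EuclideanSpace ℝ (Fin K))}
    {T : EuclideanSpace ℝ (Fin K) → EuclideanSpace ℝ (Fin K)} (hT : MeasurableEmbedding T)
    {S : Set (EuclideanSpace ℝ (Fin K))} (hS : MeasurableSet S) {c : ENNReal}
    (hc : c ≠ 0) (hc' : c ≠ ⊤)
    (h : ∀ A ⊆ S, MeasurableSet A → μ (T '' A) = c * μ A) :
    Measure.map T (unifOn K μ S) = unifOn K μ (T '' S) := by
  ext B hB
  have hBS : B ∩ T '' S = T '' (T ⁻¹' B ∩ S) := by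
    rw [Set.inter_comm (T ⁻¹' B), Set.image_inter_preimage, Set.inter_comm]
  have hm := hT.measurable hB
  rw [hT.map_apply, unifOn, unifOn, Measure.smul_apply, Measure.smul_apply,
    Measure.restrict_apply hm, Measure.restrict_apply hB, hBS,
    h _ Set.inter_subset_right (hm.inter hS), h S subset_rfl hS, smul_eq_mul, smul_eq_mul,
    ENNReal.mul_inv (Or.inl hc) (Or.inl hc'), mul_mul_mul_comm, ENNReal.inv_mul_cancel hc hc',
    one_mul]

theorem stmt5 (K : ℕ) (hK : 2 ≤ K) (θ : EuclideanSpace ℝ (Fin K)) (hθ : θ ∈ esimplex K)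
    (k : Fin K) (hθk : 0 < θ k)
    (T : EuclideanSpace ℝ (Fin K) → EuclideanSpace ℝ (Fin K))
    (hT : ∀ w, T w = w k • θ + ∑ ℓ ∈ Finset.univ.erase k, w ℓ • evtx K ℓ) :
    (∀ A : Set (EuclideanSpace ℝ (Fin K)), A ⊆ esimplex K → MeasurableSet A →
      μH[(K : ℝ) - 1] (T '' A) = ENNReal.ofReal (θ k) * μH[(K : ℝ) - 1] A) ∧
    Measure.map T (unifOn K μH[(K : ℝ) - 1] (esimplex K)) =
      unifOn K μH[(K : ℝ) - 1] (esubsimplex K k θ) := by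
  let f : Module.Dual ℝ (EuclideanSpace ℝ (Fin K)) := (EuclideanSpace.proj k).toLinearMap
  let s : Module.Dual ℝ (EuclideanSpace ℝ (Fin K)) := ∑ i, (EuclideanSpace.proj i).toLinearMap
  have hf : ∀ z, f z = z k := fun _ => rfl
  have hs : ∀ z, s z = ∑ i, z i := fun z => by simp [s]
  let L := LinearMap.transvection f (θ - evtx K k)
  have hL : ∀ w, L w = w + w k • (θ - evtx K k) := fun _ => rfl
  have hTL : T = L := by
    ext1 w
    have hw := sum_smul_evtx w
    rw [← Finset.add_sum_erase _ _ (Finset.mem_univ k)] at hw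
    rw [hT, hL, eq_sub_of_add_eq' hw, smul_sub]
    abel
  have hfu : 1 + f (θ - evtx K k) = θ k := by simp [hf, evtx_apply]
  have hscale : ∀ A ⊆ esimplex K, MeasurableSet A →
      μH[(K : ℝ) - 1] (T '' A) = ENNReal.ofReal (θ k) * μH[(K : ℝ) - 1] A := by
    intro A hA _
    have hs0 : s ≠ 0 := fun h0 => by
      have := hs θ
      simp [h0, hθ.2] at this
    have := hausdorffMeasure_image_transvection hs0 f (u := θ - evtx K k)
      (by simp [hs, evtx_apply, hθ.2]) (c := 1) (A := A) fun x hx => by rw [hs, (hA hx).2]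
    rwa [finrank_euclideanSpace_fin, hfu, abs_of_pos hθk, ← hTL] at this
  have hinj : Function.Injective L := by
    have hdet : LinearMap.det L ≠ 0 := by
      rw [LinearMap.transvection.det, hfu]
      exact hθk.ne'
    exact (LinearMap.equivOfDetNeZero L hdet).injective
  have hemb : MeasurableEmbedding T := by
    rw [hTL]
    exact (LinearMap.continuous_of_finiteDimensional L).measurableEmbedding hinj
  have himage : T '' esimplex K = esubsimplex K k θ := by
    rw [hTL, esimplex_eq_convexHull, LinearMap.image_convexHull, esubsimplex]
    congr 1
    have hk : L (evtx K k) = θ := by simp [hL, evtx_apply]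
    have hne : ∀ ℓ, ℓ ≠ k → L (evtx K ℓ) = evtx K ℓ := fun ℓ hℓ => by
      simp [hL, evtx_apply, hℓ.symm]
    ext z
    constructor
    · rintro ⟨_, ⟨ℓ, rfl⟩, rfl⟩
      by_cases h : ℓ = k
      · exact Or.inl (h ▸ hk)
      · exact Or.inr ⟨ℓ, h, hne ℓ h⟩
    · rintro (rfl | ⟨ℓ, h, rfl⟩)
      · exact ⟨_, ⟨k, rfl⟩, hk⟩
      · exact ⟨_, ⟨ℓ, rfl⟩, hne ℓ h⟩
  refine ⟨hscale, ?_⟩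
  rw [← himage]
  exact map_unifOn hemb (measurableSet_esimplex K) (by simpa using hθk) ENNReal.ofReal_ne_top
    hscale
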